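/- arXiv:0907.0814 — 3 statements merged into one kernel-verified Lean document; each statement's English description precedes it below -/
import Mathlib

section
/- Let n ≥ 2 and d ≥ 1. The number of nonsplitable set partitions of {1, 2, …, d} into at most n nonempty blocks equals the number of words of length d over the set {e} ∪ C_n in S_n that reduce to the identity permutation and do not cross the identity. -/
/-- The cycle `σ_k = (1 k k-1 ⋯ 3 2)` of `S_n` (1-based: `σ_k(1) = k`,
`σ_k(i) = i-1` for `2 ≤ i ≤ k`, `σ_k(i) = i` for `i > k`), written 0-based on `Fin n`:
it sends `0 ↦ k-1`, `i ↦ i-1` for `1 ≤ i ≤ k-1`, and fixes `i ≥ k`. -/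
def sigmaPerm (n k : ℕ) (hk : 2 ≤ k) (hkn : k ≤ n) : Equiv.Perm (Fin n) where
  toFun i := ⟨if (i : ℕ) = 0 then k - 1 else if (i : ℕ) ≤ k - 1 then (i : ℕ) - 1 else (i : ℕ),
    by have := i.isLt; split_ifs <;> omega⟩
  invFun i := ⟨if (i : ℕ) = k - 1 then 0 else if (i : ℕ) < k - 1 then (i : ℕ) + 1 else (i : ℕ),
    by have := i.isLt; split_ifs <;> omega⟩
  left_inv := by
    intro i
    have := i.isLt
    apply Fin.ext
    simp only [Fin.val_mk]
    split_ifs <;> first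
      | omega
      | (simp_all only [Fin.val_mk] <;> omega)
  right_inv := by
    intro i
    have := i.isLt
    apply Fin.ext
    simp only [Fin.val_mk]
    split_ifs <;> first
      | omega
      | (simp_all only [Fin.val_mk] <;> omega)

/-- The set `C_n = {σ_2, …, σ_n}` of the permutations of `{1, …, n}`
whose descent set is `{1}`. -/
def Cn (n : ℕ) : Finset (Equiv.Perm (Fin n)) :=
  (Finset.Icc 2 n).attach.image fun k : {x // x ∈ Finset.Icc 2 n} =>
    sigmaPerm n k.1 (Finset.mem_Icc.mp k.2).1 (Finset.mem_Icc.mp k.2).2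


/-- `A` is a set partition of `{1, …, d}`: a (finite) family of pairwise disjoint
nonempty subsets (blocks) whose union is `{1, …, d}`. -/
def IsSetPartition (d : ℕ) (A : Finset (Finset ℕ)) : Prop :=
  (∀ b ∈ A, b.Nonempty) ∧ (A : Set (Finset ℕ)).PairwiseDisjoint id ∧
    A.sup id = Finset.Icc 1 d

/-- The (1-based) index of the block `b` of a set partition `P`, when the blocks of `P`
are listed in increasing order of their minimal elements. -/
def blkIdx (P : Finset (Finset ℕ)) (b : Finset ℕ) : ℕ :=
  (P.filter fun b' => b'.min ≤ b.min).card

/-- The `j`-th block (1-based, in increasing order of minimal elements) of a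
set partition `P`. -/
def blk (P : Finset (Finset ℕ)) (j : ℕ) : Finset ℕ :=
  (P.filter fun b => blkIdx P b = j).sup id

/-- The block `C_j + n = {c + n : c ∈ C_j}`. -/
def shiftBlock (n : ℕ) (b : Finset ℕ) : Finset ℕ := b.image (· + n)

/-- The composition `B ∘ C` of a set partition `B = {B₁, …, B_k}` of `{1, …, n}` with a
set partition `C = {C₁, …, C_ℓ}` of `{1, …, m}` (blocks listed in increasing order of
minima): its blocks are `B_j ∪ (C_j + n)` for `j ≤ min(k, ℓ)` together with the leftover
blocks `C_j + n` (if `k ≤ ℓ`) or `B_j` (if `k > ℓ`). -/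
def composePartition (B C : Finset (Finset ℕ)) (n : ℕ) : Finset (Finset ℕ) :=
  ((Finset.Icc 1 (min B.card C.card)).image fun j => blk B j ∪ shiftBlock n (blk C j)) ∪
    (if B.card ≤ C.card then
      (Finset.Icc (B.card + 1) C.card).image fun j => shiftBlock n (blk C j)
    else
      (Finset.Icc (C.card + 1) B.card).image fun j => blk B j)

/-- A set partition `A` of `{1, …, d}` is splitable if `A = B ∘ C` for set partitions
`B`, `C` of nonempty ground sets `{1, …, n'}` and `{1, …, m'}` with `n' + m' = d`. -/
def Splitable (d : ℕ) (A : Finset (Finset ℕ)) : Prop :=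
  ∃ n' m' : ℕ, 1 ≤ n' ∧ 1 ≤ m' ∧ n' + m' = d ∧
    ∃ B C : Finset (Finset ℕ), IsSetPartition n' B ∧ IsSetPartition m' C ∧
      A = composePartition B C n'

/-! ### Words as random-to-top shuffles -/

/-- The letter `σ_{k+1}` of the alphabet `{e} ∪ C_n`, with `σ_1 = e`; it sends `0` to `k`. -/
def letterPerm {n : ℕ} (k : Fin n) : Equiv.Perm (Fin n) :=
  if h : 1 ≤ (k : ℕ) then sigmaPerm n (k + 1) (by omega) k.isLt else 1

theorem letterPerm_symm_val {n : ℕ} (k i : Fin n) :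
    ((letterPerm k)⁻¹ i : ℕ) =
      if (i : ℕ) = k then 0 else if (i : ℕ) < k then (i : ℕ) + 1 else i := by
  unfold letterPerm
  by_cases h : 1 ≤ (k : ℕ)
  · simp only [h, dite_true, sigmaPerm, Equiv.Perm.inv_def, Equiv.symm, Equiv.coe_fn_mk]
    split_ifs <;> omega
  · simp only [h, dite_false, inv_one, Equiv.Perm.one_apply]
    split_ifs <;> omega

theorem letterPerm_injective {n : ℕ} : Function.Injective (letterPerm (n := n)) := by
  intro k l h
  have h₁ := letterPerm_symm_val k k
  rw [h, letterPerm_symm_val] at h₁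
  ext
  by_contra hne
  split_ifs at h₁ <;> omega

theorem mem_alphabet_iff {n : ℕ} (hn : 1 ≤ n) (g : Equiv.Perm (Fin n)) :
    g ∈ insert (1 : Equiv.Perm (Fin n)) (Cn n) ↔ ∃ k, letterPerm k = g := by
  simp only [Finset.mem_insert, Cn, Finset.mem_image, Finset.mem_attach, true_and]
  constructor
  · rintro (rfl | ⟨⟨k, hk⟩, rfl⟩)
    · exact ⟨⟨0, hn⟩, by simp [letterPerm]⟩
    · rw [Finset.mem_Icc] at hk
      refine ⟨⟨k - 1, by omega⟩, ?_⟩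
      have h₁ : 1 ≤ k - 1 := by omega
      have h₂ : k - 1 + 1 = k := by omega
      simp only [letterPerm, h₁, dite_true, h₂]
  · rintro ⟨k, rfl⟩
    by_cases h : 1 ≤ (k : ℕ)
    · exact Or.inr ⟨⟨k + 1, Finset.mem_Icc.mpr ⟨by omega, k.isLt⟩⟩, by simp [letterPerm, h]⟩
    · exact Or.inl (by simp [letterPerm, h])

/-- The deck obtained from the sorted one by moving cards to the top; the labels of the moved
cards are listed from the most recent to the oldest. -/
def deck {n : ℕ} : List (Fin n) → Equiv.Perm (Fin n)
  | [] => 1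
  | a :: l => deck l * letterPerm ((deck l)⁻¹ a)

/-- The word over `{e} ∪ C_n` which performs the moves of `deck`, in chronological order. -/
def shuffleWord {n : ℕ} : List (Fin n) → List (Equiv.Perm (Fin n))
  | [] => []
  | a :: l => shuffleWord l ++ [letterPerm ((deck l)⁻¹ a)]

theorem prod_shuffleWord {n : ℕ} (l : List (Fin n)) : (shuffleWord l).prod = deck l := by
  induction l with
  | nil => rfl
  | cons a l ih => simp [shuffleWord, deck, ih]

theorem length_shuffleWord {n : ℕ} (l : List (Fin n)) :
    (shuffleWord l).length = l.length := by
  induction l with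
  | nil => rfl
  | cons a l ih => simp [shuffleWord, ih]

theorem shuffleWord_drop {n : ℕ} (l : List (Fin n)) (j : ℕ) :
    shuffleWord (l.drop j) = (shuffleWord l).take (l.length - j) := by
  induction l generalizing j with
  | nil => simp [shuffleWord]
  | cons a l ih =>
    cases j with
    | zero => rw [List.take_of_length_le (by simp [length_shuffleWord])]; rfl
    | succ j =>
      rw [List.drop_succ_cons, ih, shuffleWord,
        List.take_append_of_le_length (by simp [length_shuffleWord])]
      simp

theorem shuffleWord_injective {n : ℕ} : Function.Injective (shuffleWord (n := n)) := by
  intro l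
  induction l with
  | nil =>
    intro l' h
    cases l' with
    | nil => rfl
    | cons a l' => simp [shuffleWord] at h
  | cons a l ih =>
    intro l' h
    cases l' with
    | nil => simp [shuffleWord] at h
    | cons b l' =>
      obtain ⟨h₁, h₂⟩ := List.append_inj' h rfl
      obtain rfl := ih h₁
      simpa using letterPerm_injective (List.singleton_injective h₂)

theorem exists_shuffleWord_eq {n : ℕ} (u : List (Equiv.Perm (Fin n)))
    (hu : ∀ g ∈ u, ∃ k, letterPerm k = g) : ∃ l, shuffleWord l = u := by
  induction u using List.reverseRecOn with
  | nil => exact ⟨[], rfl⟩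
  | append_singleton u g ih =>
    obtain ⟨l, rfl⟩ := ih fun g hg => hu g (by simp [hg])
    obtain ⟨k, rfl⟩ := hu g (by simp)
    exact ⟨deck l k :: l, by simp [shuffleWord]⟩

theorem mem_shuffleWord {n : ℕ} (l : List (Fin n)) :
    ∀ g ∈ shuffleWord l, ∃ k, letterPerm k = g := by
  induction l with
  | nil => simp [shuffleWord]
  | cons a l ih =>
    intro g hg
    rcases List.mem_append.mp hg with hg | hg
    · exact ih g hg
    · exact ⟨_, (List.mem_singleton.mp hg).symm⟩

/-! ### Restricted growth words -/

/-- A word is of restricted growth if its letters first occur in increasing order, without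
gaps; a letter which does not occur has `idxOf` equal to the length of the word. -/
def IsRestrictedGrowth {α : Type*} [Preorder α] [DecidableEq α] (l : List α) : Prop :=
  Monotone fun a : α => l.idxOf a

theorem idxOf_cons_eq_ite {α : Type*} [DecidableEq α] (x a : α) (l : List α) :
    (x :: l).idxOf a = if a = x then 0 else l.idxOf a + 1 := by
  by_cases h : a = x
  · simp [h]
  · rw [List.idxOf_cons_ne _ (Ne.symm h), if_neg h]

theorem idxOf_le_of_getElem?_eq {α : Type*} [DecidableEq α] {l : List α} {a : α} {j : ℕ}
    (h : l[j]? = some a) : l.idxOf a ≤ j := by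
  induction l generalizing j with
  | nil => simp at h
  | cons x l ih =>
    rw [idxOf_cons_eq_ite]
    cases j with
    | zero => simp_all
    | succ j =>
      have := ih (j := j) (by simpa using h)
      split_ifs <;> omega

theorem deck_symm_lt_iff {n : ℕ} (l : List (Fin n)) (a b : Fin n) :
    (deck l)⁻¹ a < (deck l)⁻¹ b ↔
      l.idxOf a < l.idxOf b ∨ l.idxOf a = l.idxOf b ∧ a < b := by
  induction l with
  | nil => simp [deck]
  | cons x l ih =>
    have hinj : ∀ c d : Fin n, (((deck l)⁻¹ c : Fin n) : ℕ) = ((deck l)⁻¹ d : Fin n) ↔ c = d :=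
      fun c d => by rw [← Fin.ext_iff, ((deck l)⁻¹).injective.eq_iff]
    rw [Fin.lt_def] at ih ⊢
    simp only [deck, mul_inv_rev, Equiv.Perm.mul_apply, letterPerm_symm_val, hinj,
      idxOf_cons_eq_ite]
    have h₁ := hinj a x
    have h₂ := hinj b x
    have h₃ := hinj a b
    by_cases hax : a = x <;> by_cases hbx : b = x
    · subst hax; subst hbx; simp
    · subst hax; simp only [hbx, if_true, if_false]; split_ifs <;> omega
    · subst hbx; simp [hax]
    · simp only [hax, hbx, if_false, iff_false] at h₁ h₂ ⊢
      rw [show l.idxOf a + 1 < l.idxOf b + 1 ↔ l.idxOf a < l.idxOf b by omega,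
        show l.idxOf a + 1 = l.idxOf b + 1 ↔ l.idxOf a = l.idxOf b by omega, ← ih]
      split_ifs <;> omega

theorem deck_eq_one_iff {n : ℕ} (l : List (Fin n)) : deck l = 1 ↔ IsRestrictedGrowth l := by
  constructor
  · intro h a b hab
    rcases hab.eq_or_lt with rfl | hab
    · rfl
    · have := (deck_symm_lt_iff l a b).mp (by simpa [h] using hab)
      show l.idxOf a ≤ l.idxOf b
      omega
  · intro h
    have hmono : StrictMono ⇑(deck l)⁻¹ := fun a b hab =>
      (deck_symm_lt_iff l a b).mpr (by
        have : l.idxOf a ≤ l.idxOf b := h hab.le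
        rcases this.lt_or_eq with h | h
        · exact Or.inl h
        · exact Or.inr ⟨h, hab⟩)
    have hrange : Set.range ⇑(deck l)⁻¹ = Set.range (id : Fin n → Fin n) := by
      rw [((deck l)⁻¹).surjective.range_eq, Set.range_id]
    rw [← inv_eq_one]
    exact Equiv.ext fun a => congrFun ((hmono.range_inj strictMono_id).mp hrange) a

theorem isRestrictedGrowth_map_val {n : ℕ} (l : List (Fin n)) :
    IsRestrictedGrowth (l.map Fin.val) ↔ IsRestrictedGrowth l := by
  have hidx : ∀ a : Fin n, (l.map Fin.val).idxOf (a : ℕ) = l.idxOf a := fun a => by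
    induction l with
    | nil => rfl
    | cons x l ih => simp [idxOf_cons_eq_ite, ih, Fin.ext_iff]
  constructor
  · intro h a b hab
    simpa [hidx] using h (show (a : ℕ) ≤ b from hab)
  · intro h a b hab
    show (l.map Fin.val).idxOf a ≤ (l.map Fin.val).idxOf b
    by_cases hb : b < n
    · simpa [← hidx] using h (show (⟨a, by omega⟩ : Fin n) ≤ ⟨b, hb⟩ from hab)
    · rw [List.idxOf_of_notMem (a := b)]
      · exact List.idxOf_le_length
      · simp only [List.mem_map, not_exists, not_and]
        rintro x - rfl
        exact hb x.isLt

theorem isRestrictedGrowth_of_forall_exists {l : List ℕ}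
    (h : ∀ i (hi : i < l.length), ∀ u < l[i], ∃ j, ∃ hj : j < i, l[j] = u) :
    IsRestrictedGrowth l := by
  intro a b hab
  show l.idxOf a ≤ l.idxOf b
  rcases hab.eq_or_lt with rfl | hab
  · rfl
  by_cases hb : b ∈ l
  · have hi := List.idxOf_lt_length_iff.mpr hb
    obtain ⟨j, hj, rfl⟩ := h _ hi a (by simpa using hab)
    exact (idxOf_le_of_getElem?_eq (List.getElem?_eq_getElem (by omega))).trans hj.le
  · rw [List.idxOf_of_notMem hb]
    exact List.idxOf_le_length

namespace IsRestrictedGrowth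

variable {l l₁ l₂ : List ℕ}

theorem mem_of_le (h : IsRestrictedGrowth l) {a b : ℕ} (hab : a ≤ b) (hb : b ∈ l) : a ∈ l := by
  rw [← List.idxOf_lt_length_iff] at hb ⊢
  exact lt_of_le_of_lt (h hab) hb

theorem toFinset_eq (h : IsRestrictedGrowth l) :
    l.toFinset = Finset.range l.toFinset.card := by
  have hsub : Finset.range l.toFinset.card ⊆ l.toFinset := fun a ha => by
    by_contra hal
    have : l.toFinset ⊆ Finset.range a := fun b hb => by
      rw [Finset.mem_range]
      by_contra hab
      exact hal (List.mem_toFinset.mpr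
        (h.mem_of_le (not_lt.mp hab) (List.mem_toFinset.mp hb)))
    have := Finset.card_le_card this
    simp only [Finset.card_range, Finset.mem_range] at this ha
    omega
  exact (Finset.eq_of_subset_of_card_le hsub (by simp)).symm

theorem mem_iff (h : IsRestrictedGrowth l) {a : ℕ} : a ∈ l ↔ a < l.toFinset.card := by
  rw [← List.mem_toFinset, h.toFinset_eq, Finset.mem_range, Finset.card_range]

theorem idxOf_le_idxOf_iff (h : IsRestrictedGrowth l) {a b : ℕ} (ha : a ∈ l) :
    l.idxOf a ≤ l.idxOf b ↔ a ≤ b := by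
  refine ⟨fun hle => ?_, fun hle => h hle⟩
  by_contra hba
  have : l.idxOf a = l.idxOf b := le_antisymm hle (h (not_le.mp hba).le)
  exact hba ((List.idxOf_inj ha).mp this).le

theorem append (h₁ : IsRestrictedGrowth l₁) (h₂ : IsRestrictedGrowth l₂) :
    IsRestrictedGrowth (l₁ ++ l₂) := by
  intro a b hab
  simp only [List.idxOf_append]
  split_ifs with ha hb hb
  · exact h₁ hab
  · have := List.idxOf_lt_length_iff.mpr ha
    omega
  · exact absurd (h₁.mem_of_le hab hb) ha
  · have : l₂.idxOf a ≤ l₂.idxOf b := h₂ hab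
    omega

theorem of_append_left (h : IsRestrictedGrowth (l₁ ++ l₂)) : IsRestrictedGrowth l₁ := by
  intro a b hab
  have := h hab
  simp only [List.idxOf_append] at this ⊢
  have ha := List.idxOf_le_length (a := a) (l := l₁)
  by_cases hb : b ∈ l₁
  · have := List.idxOf_lt_length_iff.mpr hb
    split_ifs at * <;> omega
  · rwa [List.idxOf_of_notMem hb]

end IsRestrictedGrowth

/-! ### Set partitions as restricted growth words -/

/-- The set of the (1-based) positions of the letter `a` in the word `l`. -/
def letterBlock (l : List ℕ) (a : ℕ) : Finset ℕ :=
  (Finset.Icc 1 l.length).filter fun i => l[i - 1]? = some a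

/-- The set partition of the positions of a word according to their letters. -/
def wordPartition (l : List ℕ) : Finset (Finset ℕ) := l.toFinset.image (letterBlock l)

theorem mem_letterBlock {l : List ℕ} {a i : ℕ} :
    i ∈ letterBlock l a ↔ 1 ≤ i ∧ l[i - 1]? = some a := by
  simp only [letterBlock, Finset.mem_filter, Finset.mem_Icc, and_assoc]
  refine and_congr_right fun hi => and_iff_right_of_imp fun h => ?_
  obtain ⟨h, -⟩ := List.getElem?_eq_some_iff.mp h
  omega

theorem mem_of_mem_letterBlock {l : List ℕ} {a i : ℕ} (h : i ∈ letterBlock l a) : a ∈ l :=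
  List.mem_of_getElem? (mem_letterBlock.mp h).2

theorem idxOf_succ_mem_letterBlock {l : List ℕ} {a : ℕ} (h : a ∈ l) :
    l.idxOf a + 1 ∈ letterBlock l a :=
  mem_letterBlock.mpr ⟨by omega, List.getElem?_idxOf h⟩

theorem eq_of_mem_letterBlock {l : List ℕ} {a b i : ℕ} (ha : i ∈ letterBlock l a)
    (hb : i ∈ letterBlock l b) : a = b :=
  Option.some_injective _ ((mem_letterBlock.mp ha).2.symm.trans (mem_letterBlock.mp hb).2)

theorem letterBlock_injOn (l : List ℕ) : Set.InjOn (letterBlock l) {a | a ∈ l} :=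
  fun _ ha _ _ h => eq_of_mem_letterBlock (idxOf_succ_mem_letterBlock ha)
    (h ▸ idxOf_succ_mem_letterBlock ha)

theorem min_letterBlock {l : List ℕ} {a : ℕ} (h : a ∈ l) :
    (letterBlock l a).min = WithTop.some (l.idxOf a + 1) := by
  refine le_antisymm (Finset.min_le (idxOf_succ_mem_letterBlock h)) (Finset.le_min ?_)
  intro i hi
  rw [mem_letterBlock] at hi
  have := idxOf_le_of_getElem?_eq hi.2
  exact WithTop.coe_le_coe.mpr (by omega)

theorem card_wordPartition (l : List ℕ) : (wordPartition l).card = l.toFinset.card :=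
  Finset.card_image_of_injOn fun _ ha _ hb h =>
    letterBlock_injOn l (List.mem_toFinset.mp ha) (List.mem_toFinset.mp hb) h

theorem isSetPartition_wordPartition (l : List ℕ) :
    IsSetPartition l.length (wordPartition l) := by
  refine ⟨?_, ?_, ?_⟩
  · simp only [wordPartition, Finset.mem_image, List.mem_toFinset]
    rintro _ ⟨a, ha, rfl⟩
    exact ⟨_, idxOf_succ_mem_letterBlock ha⟩
  · intro b hb c hc hbc
    simp only [wordPartition, Finset.mem_coe, Finset.mem_image] at hb hc
    obtain ⟨a, -, rfl⟩ := hb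
    obtain ⟨a', -, rfl⟩ := hc
    exact Finset.disjoint_left.mpr fun i hi hi' => hbc (by rw [eq_of_mem_letterBlock hi hi'])
  · ext i
    simp only [Finset.mem_sup, wordPartition, Finset.mem_image, List.mem_toFinset, id,
      exists_exists_and_eq_and, Finset.mem_Icc]
    constructor
    · rintro ⟨a, -, hi⟩
      exact Finset.mem_Icc.mp (Finset.mem_filter.mp hi).1
    · rintro ⟨h₁, h₂⟩
      have hi : i ∈ letterBlock l l[i - 1] :=
        mem_letterBlock.mpr ⟨h₁, List.getElem?_eq_getElem (by omega)⟩
      exact ⟨_, mem_of_mem_letterBlock hi, hi⟩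

theorem blkIdx_letterBlock {l : List ℕ} (h : IsRestrictedGrowth l) {a : ℕ} (ha : a ∈ l) :
    blkIdx (wordPartition l) (letterBlock l a) = a + 1 := by
  rw [blkIdx, wordPartition, Finset.filter_image, Finset.card_image_of_injOn]
  · rw [← Finset.card_range (a + 1)]
    congr 1
    ext c
    simp only [Finset.mem_filter, List.mem_toFinset, Finset.mem_range, Nat.lt_succ_iff]
    constructor
    · rintro ⟨hc, hle⟩
      rw [min_letterBlock hc, min_letterBlock ha, WithTop.coe_le_coe,
        add_le_add_iff_right] at hle
      exact (h.idxOf_le_idxOf_iff hc).mp hle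
    · intro hle
      have hc := h.mem_of_le hle ha
      refine ⟨hc, ?_⟩
      rw [min_letterBlock hc, min_letterBlock ha, WithTop.coe_le_coe, add_le_add_iff_right]
      exact h hle
  · intro _ ha _ hb h
    simp only [Finset.coe_filter, Set.mem_ofPred_eq, List.mem_toFinset] at ha hb
    exact letterBlock_injOn l ha.1 hb.1 h

theorem blk_wordPartition {l : List ℕ} (h : IsRestrictedGrowth l) (a : ℕ) :
    blk (wordPartition l) (a + 1) = letterBlock l a := by
  ext i
  simp only [blk, Finset.mem_sup, Finset.mem_filter, id]
  constructor
  · rintro ⟨b, ⟨hb, hidx⟩, hi⟩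
    obtain ⟨c, hc, rfl⟩ := Finset.mem_image.mp hb
    rw [blkIdx_letterBlock h (List.mem_toFinset.mp hc), add_left_inj] at hidx
    exact hidx ▸ hi
  · intro hi
    have ha := mem_of_mem_letterBlock hi
    exact ⟨_, ⟨Finset.mem_image_of_mem _ (List.mem_toFinset.mpr ha),
      blkIdx_letterBlock h ha⟩, hi⟩

theorem wordPartition_injective {l l' : List ℕ} (h : IsRestrictedGrowth l)
    (h' : IsRestrictedGrowth l') (heq : wordPartition l = wordPartition l') : l = l' := by
  have hblock : ∀ a, letterBlock l a = letterBlock l' a := fun a => by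
    rw [← blk_wordPartition h, ← blk_wordPartition h', heq]
  refine List.ext_getElem? fun i => Option.ext fun a => ?_
  have := Finset.ext_iff.mp (hblock a) (i + 1)
  simpa [mem_letterBlock] using this

theorem blk_eq_empty_of_card_lt {P : Finset (Finset ℕ)} {j : ℕ} (h : P.card < j) :
    blk P j = ∅ := by
  rw [blk, Finset.filter_false_of_mem, Finset.sup_empty, Finset.bot_eq_empty]
  intro b _ hb
  have : blkIdx P b ≤ P.card := Finset.card_filter_le _ _
  omega

theorem composePartition_eq_image (B C : Finset (Finset ℕ)) (n : ℕ) :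
    composePartition B C n =
      (Finset.range (max B.card C.card)).image fun a =>
        blk B (a + 1) ∪ shiftBlock n (blk C (a + 1)) := by
  have hshift : ∀ M, ((Finset.range M).image fun a =>
      blk B (a + 1) ∪ shiftBlock n (blk C (a + 1))) =
      (Finset.Icc 1 M).image fun j => blk B j ∪ shiftBlock n (blk C j) := fun M => by
    ext b
    simp only [Finset.mem_image, Finset.mem_range, Finset.mem_Icc]
    constructor
    · rintro ⟨a, ha, rfl⟩
      exact ⟨a + 1, by omega, rfl⟩
    · rintro ⟨j, hj, rfl⟩
      exact ⟨j - 1, by omega, by rw [Nat.sub_add_cancel hj.1]⟩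
  rw [hshift, composePartition]
  split_ifs with h
  · rw [Finset.image_congr (s := Finset.Icc (B.card + 1) C.card)
      (g := fun j => blk B j ∪ shiftBlock n (blk C j)), ← Finset.image_union]
    · congr 1
      ext j
      simp only [Finset.mem_union, Finset.mem_Icc]
      omega
    · intro j hj
      have hj := Finset.mem_Icc.mp hj
      simp [blk_eq_empty_of_card_lt (P := B) (j := j) (by omega)]
  · rw [Finset.image_congr (s := Finset.Icc (C.card + 1) B.card)
      (g := fun j => blk B j ∪ shiftBlock n (blk C j)), ← Finset.image_union]
    · congr 1
      ext j
      simp only [Finset.mem_union, Finset.mem_Icc]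
      omega
    · intro j hj
      have hj := Finset.mem_Icc.mp hj
      simp [blk_eq_empty_of_card_lt (P := C) (j := j) (by omega), shiftBlock]

theorem letterBlock_append (l₁ l₂ : List ℕ) (a : ℕ) :
    letterBlock (l₁ ++ l₂) a =
      letterBlock l₁ a ∪ shiftBlock l₁.length (letterBlock l₂ a) := by
  ext i
  simp only [shiftBlock, Finset.mem_union, Finset.mem_image, mem_letterBlock,
    List.getElem?_append]
  split_ifs with hi
  · refine ⟨Or.inl, ?_⟩
    rintro (h | ⟨k, hk, rfl⟩)
    · exact h
    · omega
  · constructor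
    · rintro ⟨h₁, h₂⟩
      refine Or.inr ⟨i - l₁.length, ⟨by omega, ?_⟩, by omega⟩
      rwa [show i - l₁.length - 1 = i - 1 - l₁.length by omega]
    · rintro (⟨-, h⟩ | ⟨k, ⟨hk, h⟩, rfl⟩)
      · obtain ⟨h, -⟩ := List.getElem?_eq_some_iff.mp h
        omega
      · refine ⟨by omega, ?_⟩
        rwa [show k + l₁.length - 1 - l₁.length = k - 1 by omega]

/-- Composition of set partitions is concatenation of restricted growth words. -/
theorem composePartition_wordPartition {l₁ l₂ : List ℕ} (h₁ : IsRestrictedGrowth l₁)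
    (h₂ : IsRestrictedGrowth l₂) :
    composePartition (wordPartition l₁) (wordPartition l₂) l₁.length =
      wordPartition (l₁ ++ l₂) := by
  show _ = (l₁ ++ l₂).toFinset.image (letterBlock (l₁ ++ l₂))
  rw [composePartition_eq_image]
  simp only [blk_wordPartition h₁, blk_wordPartition h₂, ← letterBlock_append,
    card_wordPartition]
  congr 1
  ext a
  simp only [List.toFinset_append, Finset.mem_union, List.mem_toFinset, h₁.mem_iff, h₂.mem_iff,
    Finset.mem_range, lt_max_iff]

theorem IsSetPartition.eq_of_mem {d : ℕ} {A : Finset (Finset ℕ)} (hA : IsSetPartition d A)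
    {b c : Finset ℕ} (hb : b ∈ A) (hc : c ∈ A) {i : ℕ} (hib : i ∈ b) (hic : i ∈ c) : b = c := by
  by_contra hbc
  exact Finset.disjoint_left.mp (hA.2.1 hb hc hbc) hib hic

theorem blkIdx_lt_blkIdx {A : Finset (Finset ℕ)} {b c : Finset ℕ} (hc : c ∈ A)
    (h : b.min < c.min) : blkIdx A b < blkIdx A c := by
  refine Finset.card_lt_card (Finset.ssubset_iff_subset_ne.mpr ⟨fun e he => ?_, fun heq => ?_⟩)
  · rw [Finset.mem_filter] at he ⊢
    exact ⟨he.1, he.2.trans h.le⟩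
  · have : c ∈ A.filter fun e => e.min ≤ b.min := by
      rw [heq]
      exact Finset.mem_filter.mpr ⟨hc, le_rfl⟩
    exact (Finset.mem_filter.mp this).2.not_gt h

theorem IsSetPartition.blkIdx_injOn {d : ℕ} {A : Finset (Finset ℕ)} (hA : IsSetPartition d A) :
    Set.InjOn (blkIdx A) (A : Set (Finset ℕ)) := by
  intro b hb c hc h
  rcases lt_trichotomy b.min c.min with hlt | heq | hlt
  · exact absurd h (blkIdx_lt_blkIdx hc hlt).ne
  · obtain ⟨i, hi⟩ := Finset.min_of_nonempty (hA.1 b hb)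
    exact hA.eq_of_mem hb hc (Finset.mem_of_min hi) (Finset.mem_of_min (heq ▸ hi))
  · exact absurd h (blkIdx_lt_blkIdx hb hlt).ne'

theorem IsSetPartition.image_blkIdx {d : ℕ} {A : Finset (Finset ℕ)}
    (hA : IsSetPartition d A) : A.image (blkIdx A) = Finset.Icc 1 A.card := by
  refine Finset.eq_of_subset_of_card_le ?_ ?_
  · intro j hj
    obtain ⟨b, hb, rfl⟩ := Finset.mem_image.mp hj
    exact Finset.mem_Icc.mpr ⟨Finset.card_pos.mpr ⟨b, Finset.mem_filter.mpr ⟨hb, le_rfl⟩⟩,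
      Finset.card_filter_le _ _⟩
  · rw [Finset.card_image_of_injOn hA.blkIdx_injOn]
    simp

theorem IsSetPartition.exists_wordPartition_eq {d : ℕ} {A : Finset (Finset ℕ)}
    (hA : IsSetPartition d A) :
    ∃ l : List ℕ, l.length = d ∧ IsRestrictedGrowth l ∧ wordPartition l = A := by
  have hcover : ∀ i, ∃ b, i < d → b ∈ A ∧ i + 1 ∈ b := fun i => by
    by_cases hi : i < d
    · have : i + 1 ∈ A.sup id := by
        rw [hA.2.2, Finset.mem_Icc]
        omega
      obtain ⟨b, hb, hib⟩ := Finset.mem_sup.mp this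
      exact ⟨b, fun _ => ⟨hb, hib⟩⟩
    · exact ⟨∅, fun h => absurd h hi⟩
  choose blockOf hblockOf using hcover
  have hbound : ∀ b ∈ A, ∀ i ∈ b, 1 ≤ i ∧ i ≤ d := fun b hb i hi => by
    rw [← Finset.mem_Icc, ← hA.2.2]
    exact Finset.mem_sup.mpr ⟨b, hb, hi⟩
  have hpos : ∀ b ∈ A, 1 ≤ blkIdx A b ∧ blkIdx A b ≤ A.card := fun b hb => by
    rw [← Finset.mem_Icc, ← hA.image_blkIdx]
    exact Finset.mem_image_of_mem _ hb
  have hunique : ∀ b ∈ A, ∀ i, i + 1 ∈ b → blockOf i = b := fun b hb i hi => by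
    have := hblockOf i (by have := hbound b hb _ hi; omega)
    exact hA.eq_of_mem this.1 hb this.2 hi
  set l : List ℕ := (List.range d).map fun i => blkIdx A (blockOf i) - 1 with hl
  have hlen : l.length = d := by simp [hl]
  have hget : ∀ i a, l[i]? = some a ↔ i < d ∧ blkIdx A (blockOf i) - 1 = a := fun i a => by
    by_cases hi : i < d <;> simp [hl, hi]
  have hblock : ∀ b ∈ A, letterBlock l (blkIdx A b - 1) = b := fun b hb => by
    ext i
    rw [mem_letterBlock, hget]
    constructor
    · rintro ⟨hi, hid, heq⟩
      obtain ⟨h₁, h₂⟩ := hblockOf _ hid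
      have h₃ := hpos _ h₁
      have h₄ := hpos _ hb
      rw [Nat.sub_add_cancel hi] at h₂
      rwa [← hA.blkIdx_injOn h₁ hb (by omega)]
    · intro hi
      have := hbound b hb i hi
      refine ⟨this.1, by omega, ?_⟩
      rw [hunique b hb (i - 1) (by rwa [Nat.sub_add_cancel this.1])]
  refine ⟨l, hlen, isRestrictedGrowth_of_forall_exists fun i hi u hu => ?_, ?_⟩
  · have hid : i < d := hlen ▸ hi
    obtain ⟨h₁, h₂⟩ := hblockOf i hid
    have hli : l[i] = blkIdx A (blockOf i) - 1 := by simp [hl]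
    rw [hli] at hu
    have hmem : u + 1 ∈ A.image (blkIdx A) := by
      rw [hA.image_blkIdx, Finset.mem_Icc]
      have := hpos _ h₁
      omega
    obtain ⟨b, hb, hbu⟩ := Finset.mem_image.mp hmem
    have hmin : b.min < (blockOf i).min := by
      by_contra hge
      rcases (not_lt.mp hge).lt_or_eq with hlt | heq
      · have := blkIdx_lt_blkIdx hb hlt
        omega
      · have : blkIdx A (blockOf i) = blkIdx A b := by rw [blkIdx, blkIdx, heq]
        omega
    obtain ⟨j, hj⟩ := Finset.min_of_nonempty (hA.1 b hb)
    have hjb := Finset.mem_of_min hj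
    have hji : j < i + 1 :=
      WithTop.coe_lt_coe.mp (hj ▸ hmin.trans_le (Finset.min_le h₂))
    have hj₁ := (hbound b hb j hjb).1
    refine ⟨j - 1, by omega, ?_⟩
    have : l[j - 1]? = some u := (hget _ _).mpr
      ⟨by omega, by rw [hunique b hb (j - 1) (by rwa [Nat.sub_add_cancel hj₁])]; omega⟩
    exact (List.getElem?_eq_some_iff.mp this).2
  · ext b
    simp only [wordPartition, Finset.mem_image, List.mem_toFinset]
    constructor
    · rintro ⟨a, ha, rfl⟩
      obtain ⟨i, hi⟩ := List.mem_iff_getElem?.mp ha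
      obtain ⟨hid, rfl⟩ := (hget i a).mp hi
      rw [hblock _ (hblockOf i hid).1]
      exact (hblockOf i hid).1
    · intro hb
      refine ⟨_, ?_, hblock b hb⟩
      obtain ⟨i, hi⟩ := hA.1 b hb
      exact mem_of_mem_letterBlock (by rwa [hblock b hb])

theorem splitable_wordPartition_iff {l : List ℕ} (h : IsRestrictedGrowth l) :
    Splitable l.length (wordPartition l) ↔
      ∃ j, 0 < j ∧ j < l.length ∧ IsRestrictedGrowth (l.drop j) := by
  constructor
  · rintro ⟨p, q, hp, hq, hpq, B, C, hB, hC, heq⟩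
    obtain ⟨l₁, rfl, h₁, rfl⟩ := hB.exists_wordPartition_eq
    obtain ⟨l₂, rfl, h₂, rfl⟩ := hC.exists_wordPartition_eq
    rw [composePartition_wordPartition h₁ h₂] at heq
    obtain rfl := wordPartition_injective h (h₁.append h₂) heq
    exact ⟨l₁.length, hp, by omega, by simpa using h₂⟩
  · rintro ⟨j, hj, hjl, hdrop⟩
    have htake : IsRestrictedGrowth (l.take j) :=
      IsRestrictedGrowth.of_append_left (l₂ := l.drop j) (by rwa [List.take_append_drop])
    have hlen : (l.take j).length = j := by simp [hjl.le]
    refine ⟨j, l.length - j, hj, by omega, by omega, wordPartition (l.take j),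
      wordPartition (l.drop j), ?_, ?_, ?_⟩
    · simpa only [hlen] using isSetPartition_wordPartition (l.take j)
    · simpa only [List.length_drop] using isSetPartition_wordPartition (l.drop j)
    · have := composePartition_wordPartition htake hdrop
      rw [hlen, List.take_append_drop] at this
      exact this.symm

/-! ### The two bijections -/

/-- Words over `Fin n` of length `d` and of restricted growth, none of whose proper nonempty
suffixes is of restricted growth. -/
def IsIrreducibleGrowth {n : ℕ} (d : ℕ) (l : List (Fin n)) : Prop :=
  l.length = d ∧ IsRestrictedGrowth l ∧
    ∀ j, 0 < j → j < d → ¬ IsRestrictedGrowth (l.drop j)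

theorem card_nonsplitable_eq_card_irreducibleGrowth (n d : ℕ) :
    Nat.card {A : Finset (Finset ℕ) // IsSetPartition d A ∧ A.card ≤ n ∧ ¬ Splitable d A} =
      Nat.card {l : List (Fin n) // IsIrreducibleGrowth d l} := by
  have hsplit : ∀ l : List (Fin n), IsRestrictedGrowth l →
      (Splitable l.length (wordPartition (l.map Fin.val)) ↔
        ∃ j, 0 < j ∧ j < l.length ∧ IsRestrictedGrowth (l.drop j)) := fun l h => by
    have := splitable_wordPartition_iff ((isRestrictedGrowth_map_val l).mpr h)
    simpa only [List.length_map, ← List.map_drop, isRestrictedGrowth_map_val] using this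
  symm
  refine Nat.card_eq_of_bijective (fun l => ⟨wordPartition (l.1.map Fin.val), ?_⟩) ⟨?_, ?_⟩
  · obtain ⟨l, rfl, h, hdrop⟩ := l
    refine ⟨by simpa using isSetPartition_wordPartition (l.map Fin.val), ?_, ?_⟩
    · rw [card_wordPartition]
      refine (Finset.card_le_card fun a ha => ?_).trans_eq (Finset.card_range n)
      obtain ⟨x, -, rfl⟩ := List.mem_map.mp (List.mem_toFinset.mp ha)
      exact Finset.mem_range.mpr x.isLt
    · rw [hsplit l h]
      rintro ⟨j, hj, hjl, hg⟩
      exact hdrop j hj hjl hg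
  · rintro ⟨l, hl⟩ ⟨l', hl'⟩ heq
    have := wordPartition_injective ((isRestrictedGrowth_map_val l).mpr hl.2.1)
      ((isRestrictedGrowth_map_val l').mpr hl'.2.1) (congrArg Subtype.val heq)
    exact Subtype.ext (List.map_injective_iff.mpr Fin.val_injective this)
  · rintro ⟨A, hA, hcard, hns⟩
    obtain ⟨l, rfl, h, rfl⟩ := hA.exists_wordPartition_eq
    rw [card_wordPartition] at hcard
    obtain ⟨l, rfl⟩ : ∃ l' : List (Fin n), l'.map Fin.val = l :=
      ⟨l.pmap Fin.mk fun a ha => (h.mem_iff.mp ha).trans_le hcard, by simp [List.map_pmap]⟩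
    rw [isRestrictedGrowth_map_val] at h
    rw [List.length_map, hsplit l h] at hns
    exact ⟨⟨l, by simp, h, fun j hj hjl hg => hns ⟨j, hj, by simpa using hjl, hg⟩⟩, rfl⟩

theorem irreducibleGrowth_iff_prod_shuffleWord {n d : ℕ} {l : List (Fin n)}
    (hlen : l.length = d) :
    IsIrreducibleGrowth d l ↔ (shuffleWord l).prod = 1 ∧
      ∀ j : ℕ, 0 < j → j < d → ((shuffleWord l).take j).prod ≠ 1 := by
  have htake : ∀ j, j ≤ d → ((shuffleWord l).take j).prod = deck (l.drop (d - j)) := by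
    intro j hj
    rw [← prod_shuffleWord, shuffleWord_drop, hlen, Nat.sub_sub_self hj]
  rw [IsIrreducibleGrowth, prod_shuffleWord, deck_eq_one_iff]
  refine ⟨fun ⟨_, h, hdrop⟩ => ⟨h, fun j hj hjd => ?_⟩,
    fun ⟨h, hdrop⟩ => ⟨hlen, h, fun j hj hjd => ?_⟩⟩
  · rw [htake j hjd.le, Ne, deck_eq_one_iff]
    exact hdrop _ (by omega) (by omega)
  · have := hdrop (d - j) (by omega) (by omega)
    rwa [htake _ (by omega), Ne, deck_eq_one_iff, Nat.sub_sub_self hjd.le] at this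

theorem card_irreducibleGrowth_eq_wordCount (n d : ℕ) (hn : 1 ≤ n) :
    Nat.card {l : List (Fin n) // IsIrreducibleGrowth d l} =
      Nat.card {w : Fin d → {x // x ∈ insert (1 : Equiv.Perm (Fin n)) (Cn n)} //
        (List.ofFn fun i => ((w i : Equiv.Perm (Fin n)))).prod = 1 ∧
        ∀ j : ℕ, 0 < j → j < d →
          ((List.ofFn fun i => ((w i : Equiv.Perm (Fin n)))).take j).prod ≠ 1} := by
  have hofFn : ∀ l : List (Fin n), ∀ hlen : l.length = d,
      (List.ofFn fun i : Fin d =>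
        (shuffleWord l)[(i : ℕ)]'(by rw [length_shuffleWord, hlen]; exact i.isLt)) =
        shuffleWord l := fun l hlen =>
    List.ext_getElem (by simp [length_shuffleWord, hlen]) (by simp)
  refine Nat.card_eq_of_bijective (fun l => ⟨fun i =>
    ⟨(shuffleWord l.1)[(i : ℕ)]'(by rw [length_shuffleWord, l.2.1]; exact i.isLt),
      (mem_alphabet_iff hn _).mpr (mem_shuffleWord _ _ (List.getElem_mem _))⟩, ?_⟩) ⟨?_, ?_⟩
  · simp only [hofFn l.1 l.2.1]
    exact (irreducibleGrowth_iff_prod_shuffleWord l.2.1).mp l.2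
  · rintro ⟨l, hl⟩ ⟨l', hl'⟩ heq
    refine Subtype.ext (shuffleWord_injective ?_)
    rw [← hofFn l hl.1, ← hofFn l' hl'.1]
    congr 1
    funext i
    exact congrArg Subtype.val (congrFun (congrArg Subtype.val heq) i)
  · rintro ⟨w, hw⟩
    obtain ⟨l, hl⟩ := exists_shuffleWord_eq (List.ofFn fun i => (w i : Equiv.Perm (Fin n)))
      fun g hg => by
        obtain ⟨i, rfl⟩ := (List.mem_ofFn' _ _).mp hg
        exact (mem_alphabet_iff hn _).mp (w i).2
    have hlen : l.length = d := by rw [← length_shuffleWord, hl, List.length_ofFn]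
    rw [← hl] at hw
    refine ⟨⟨l, (irreducibleGrowth_iff_prod_shuffleWord hlen).mpr hw⟩, ?_⟩
    refine Subtype.ext (funext fun i => Subtype.ext ?_)
    simp [hl]

/-- **Nonsplitable set partitions count words which do not cross the identity.**
For `n ≥ 2` and `d ≥ 1`, the number of nonsplitable set partitions of `{1, …, d}` into
at most `n` nonempty blocks equals the number of words of length `d` over `{e} ∪ C_n`
which reduce to the identity permutation without crossing the identity. -/
theorem nonsplitable_setPartition_count_eq_wordCount (n : ℕ) (hn : 2 ≤ n)
    (d : ℕ) (hd : 1 ≤ d) :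
    Nat.card {A : Finset (Finset ℕ) //
        IsSetPartition d A ∧ A.card ≤ n ∧ ¬ Splitable d A} =
      Nat.card {w : Fin d → {x // x ∈ insert (1 : Equiv.Perm (Fin n)) (Cn n)} //
        (List.ofFn fun i => ((w i : Equiv.Perm (Fin n)))).prod = 1 ∧
        ∀ j : ℕ, 0 < j → j < d →
          ((List.ofFn fun i => ((w i : Equiv.Perm (Fin n)))).take j).prod ≠ 1} := by
  rw [card_nonsplitable_eq_card_irreducibleGrowth,
    card_irreducibleGrowth_eq_wordCount n d (by omega)]
end

section
/- Let m = 2k be even with k ≥ 1 and let D_m = ⟨s, r | s² = r^m = srsr = e⟩. In the real group algebra ℝ[D_m] set y_i = r^{1−i}s + r^i for 1 ≤ i ≤ k−1 (exponents taken modulo m). Then: (i) the 2k+2 elements e, r^k, rs, r^{k+1}s, y_1, …, y_{k−1}, y_1·rs, …, y_{k−1}·rs are linearly independent and their ℝ-linear span Q is closed under the multiplication of ℝ[D_m]; (ii) the ℝ-linear map θ : Q → ClassFun_ℝ(D_m) determined by θ(e) = id, θ(rs) = ε, θ(r^k) = γ, θ(r^{k+1}s) = γε, and θ(y_i) = θ(y_i·rs)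 = χ_i for 1 ≤ i ≤ k−1 is multiplicative (θ(fg) = θ(f)·θ(g) pointwise for all f, g ∈ Q) and its image is the ℝ-linear span of the irreducible characters of D_m. -/
open DihedralGroup

/-- The group-algebra element corresponding to `g ∈ D_m`. -/
noncomputable def sg {m : ℕ} (g : DihedralGroup m) : MonoidAlgebra ℝ (DihedralGroup m) :=
  MonoidAlgebra.single g 1

/-- `y_i = r^{1-i} s + r^i` in `ℝ[D_m]`; in Mathlib's presentation of the dihedral group
(`s = sr 0`, `r = r 1`) one has `r^{1-i} s = sr (i - 1)`. -/
noncomputable def yElt (m : ℕ) (i : ℕ) : MonoidAlgebra ℝ (DihedralGroup m) :=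
  sg (sr ((i : ZMod m) - 1)) + sg (r (i : ZMod m))

/-- `rs = r · s = sr (-1)` in `ℝ[D_m]`. -/
noncomputable def rsElt (m : ℕ) : MonoidAlgebra ℝ (DihedralGroup m) := sg (sr (-1))

/-- The trivial character `id` of `D_m`. -/
noncomputable def chiId (m : ℕ) : DihedralGroup m → ℝ := fun _ => 1

/-- The character `ε` of `D_m`: `ε(rᵃ) = 1`, `ε(rᵃs) = -1`. -/
noncomputable def chiEps (m : ℕ) : DihedralGroup m → ℝ
  | .r _ => 1
  | .sr _ => -1

/-- The character `γ` of `D_m` (`m` even): `γ(rᵃ) = (-1)ᵃ`, `γ(rᵃs) = (-1)ᵃ`. -/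
noncomputable def chiGamma (m : ℕ) : DihedralGroup m → ℝ
  | .r a => (-1 : ℝ) ^ a.val
  | .sr a => (-1 : ℝ) ^ a.val

/-- The character `γε` of `D_m` (`m` even): `γε(rᵃ) = (-1)ᵃ`, `γε(rᵃs) = (-1)^{a+1}`. -/
noncomputable def chiGammaEps (m : ℕ) : DihedralGroup m → ℝ
  | .r a => (-1 : ℝ) ^ a.val
  | .sr a => (-1 : ℝ) ^ (a.val + 1)

/-- The two-dimensional character `χ_j` of `D_m`: `χ_j(rᵃ) = 2cos(2πja/m)`,
`χ_j(rᵃs) = 0`. -/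
noncomputable def chiJ (m : ℕ) (j : ℕ) : DihedralGroup m → ℝ
  | .r a => 2 * Real.cos (2 * Real.pi * j * a.val / m)
  | .sr _ => 0

/-- The family `e, r^k, rs, r^{k+1}s, y_1, …, y_{k-1}, y_1·rs, …, y_{k-1}·rs`
in `ℝ[D_m]` for `m = 2k` even. -/
noncomputable def famEven (k : ℕ) :
    (Fin 4 ⊕ (Fin (k - 1) ⊕ Fin (k - 1))) → MonoidAlgebra ℝ (DihedralGroup (2 * k)) :=
  Sum.elim
    ![sg 1, sg (r (k : ZMod (2 * k))), rsElt (2 * k), sg (sr (-(k + 1 : ZMod (2 * k))))]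
    (Sum.elim (fun i => yElt (2 * k) (i.val + 1))
      (fun i => yElt (2 * k) (i.val + 1) * rsElt (2 * k)))

/-- The function `x ↦ cos(2πx/m)` on `ℤ/m`. -/
noncomputable def cosZMod {m : ℕ} (x : ZMod m) : ℝ :=
  Real.cos (2 * Real.pi * x.val / m)

@[simp]
theorem cosZMod_zero {m : ℕ} : cosZMod (0 : ZMod m) = 1 := by
  simp [cosZMod]

section cosZMod

variable {m : ℕ} [NeZero m]

theorem cosZMod_intCast (n : ℤ) : cosZMod (n : ZMod m) = Real.cos (2 * Real.pi * n / m) := by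
  have hm : (m : ℝ) ≠ 0 := NeZero.ne _
  have h : (((n : ZMod m).val : ℤ)) = n - m * (n / m) := by
    rw [ZMod.val_intCast, Int.emod_def]
  have h' : (((n : ZMod m).val : ℝ)) = n - m * ((n / m : ℤ) : ℝ) := by exact_mod_cast h
  rw [cosZMod, h', ← Real.cos_sub_int_mul_two_pi (2 * Real.pi * n / m) (n / m)]
  congr 1
  field_simp

theorem cosZMod_natCast (n : ℕ) : cosZMod (n : ZMod m) = Real.cos (2 * Real.pi * n / m) := by
  simpa using cosZMod_intCast (m := m) n

@[simp]
theorem cosZMod_neg (x : ZMod m) : cosZMod (-x) = cosZMod x := by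
  obtain ⟨n, rfl⟩ := ZMod.intCast_surjective x
  rw [← Int.cast_neg, cosZMod_intCast, cosZMod_intCast, ← Real.cos_neg]
  congr 1
  push_cast
  ring

theorem cosZMod_add_add_cosZMod_sub (x y : ZMod m) :
    cosZMod (x + y) + cosZMod (x - y) = 2 * cosZMod x * cosZMod y := by
  obtain ⟨a, rfl⟩ := ZMod.intCast_surjective x
  obtain ⟨b, rfl⟩ := ZMod.intCast_surjective y
  rw [← Int.cast_add, ← Int.cast_sub]
  simp only [cosZMod_intCast]
  push_cast
  rw [show 2 * Real.pi * ((a : ℝ) + b) / m = 2 * Real.pi * a / m + 2 * Real.pi * b / m by ring,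
    show 2 * Real.pi * ((a : ℝ) - b) / m = 2 * Real.pi * a / m - 2 * Real.pi * b / m by ring,
    Real.cos_add, Real.cos_sub]
  ring

end cosZMod

theorem natCast_half_add_self (k : ℕ) : (k : ZMod (2 * k)) + k = 0 := by
  rw [← two_mul]
  exact_mod_cast ZMod.natCast_self (2 * k)

theorem neg_natCast_half (k : ℕ) : -(k : ZMod (2 * k)) = k :=
  neg_eq_of_add_eq_zero_left (natCast_half_add_self k)

section half

variable {k : ℕ} [NeZero k]

theorem cosZMod_half_mul (a : ZMod (2 * k)) : cosZMod ((k : ZMod (2 * k)) * a) = (-1) ^ a.val := by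
  have hk : (k : ℝ) ≠ 0 := NeZero.ne _
  have h : (k : ZMod (2 * k)) * a = ((k * a.val : ℕ) : ZMod (2 * k)) := by
    rw [Nat.cast_mul, ZMod.natCast_zmod_val]
  rw [h, cosZMod_natCast, ← Real.cos_nat_mul_pi]
  congr 1
  push_cast
  field_simp

theorem cosZMod_add_half_mul (x a : ZMod (2 * k)) :
    cosZMod (x + (k : ZMod (2 * k)) * a) = cosZMod x * cosZMod ((k : ZMod (2 * k)) * a) := by
  have h := cosZMod_add_add_cosZMod_sub x ((k : ZMod (2 * k)) * a)
  rw [sub_eq_add_neg, ← neg_mul, neg_natCast_half] at h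
  linarith

theorem cosZMod_half_mul_mul_self (a : ZMod (2 * k)) :
    cosZMod ((k : ZMod (2 * k)) * a) * cosZMod ((k : ZMod (2 * k)) * a) = 1 := by
  rw [← cosZMod_add_half_mul, ← add_mul, natCast_half_add_self]
  simp

end half

theorem coeff_sg {m : ℕ} [DecidableEq (DihedralGroup m)] (g h : DihedralGroup m) :
    (sg g).coeff h = if g = h then 1 else 0 := by
  simp [sg, Finsupp.single_apply]

theorem sg_mul_sg {m : ℕ} (g h : DihedralGroup m) : sg g * sg h = sg (g * h) := by
  simp [sg, MonoidAlgebra.single_mul_single]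

/-- The element `r^{1-i} s + r^i` of `ℝ[D_m]` for a residue `i` modulo `m`. -/
noncomputable def yResidue {m : ℕ} (i : ZMod m) : MonoidAlgebra ℝ (DihedralGroup m) :=
  sg (sr (i - 1)) + sg (r i)

theorem yResidue_mul_rsElt {m : ℕ} (i : ZMod m) : yResidue i * rsElt m = yResidue (-i) := by
  simp only [yResidue, rsElt, add_mul, sg_mul_sg, sr_mul_sr, r_mul_sr]
  rw [add_comm]
  congr 3 <;> ring

theorem yResidue_mul_yResidue {m : ℕ} (i j : ZMod m) :
    yResidue i * yResidue j = yResidue (i + j) + yResidue (j - i) := by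
  simp only [yResidue, add_mul, mul_add, sg_mul_sg, sr_mul_sr, sr_mul_r, r_mul_sr, r_mul_r]
  ring_nf
  abel

/-- The Klein subgroup `{e, r^k, rs, r^{k+1}s}` of `D_{2k}`. -/
def kleinSet (k : ℕ) : Set (DihedralGroup (2 * k)) :=
  {1, r (k : ZMod (2 * k)), sr (-1), sr (-(k + 1 : ZMod (2 * k)))}

/-- Generators of the span of `famEven k`, with the `y_i` indexed by all residues. -/
def evenGenerators (k : ℕ) : Set (MonoidAlgebra ℝ (DihedralGroup (2 * k))) :=
  sg '' kleinSet k ∪ Set.range yResidue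

theorem mul_mem_kleinSet {k : ℕ} {g h : DihedralGroup (2 * k)} (hg : g ∈ kleinSet k)
    (hh : h ∈ kleinSet k) : g * h ∈ kleinSet k := by
  have hkk := natCast_half_add_self k
  simp only [kleinSet, Set.mem_insert_iff, Set.mem_singleton_iff, one_def] at hg hh ⊢
  rcases hg with rfl | rfl | rfl | rfl <;> rcases hh with rfl | rfl | rfl | rfl <;>
    simp only [r_mul_r, r_mul_sr, sr_mul_r, sr_mul_sr, r.injEq, sr.injEq, reduceCtorEq] <;>
    grind

theorem exists_of_mem_kleinSet {k : ℕ} {g : DihedralGroup (2 * k)} (hg : g ∈ kleinSet k) :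
    ∃ z : ZMod (2 * k), (z = 0 ∨ z = k) ∧ (g = r z ∨ g = sr (-1 - z)) := by
  simp only [kleinSet, Set.mem_insert_iff, Set.mem_singleton_iff, one_def] at hg
  rcases hg with rfl | rfl | rfl | rfl
  · exact ⟨0, by simp⟩
  · exact ⟨k, by simp⟩
  · exact ⟨0, by simp⟩
  · exact ⟨k, .inr rfl, .inr (by ring_nf)⟩

theorem add_self_eq_zero_of_eq_zero_or_half {k : ℕ} {z : ZMod (2 * k)} (hz : z = 0 ∨ z = k) :
    z + z = 0 := by
  rcases hz with rfl | rfl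
  · simp
  · exact natCast_half_add_self k

theorem yResidue_mul_sg_r {m : ℕ} (i z : ZMod m) :
    yResidue i * sg (r z) = yResidue (i + z) := by
  simp only [yResidue, add_mul, sg_mul_sg, r_mul_r, sr_mul_r]
  congr 3
  ring

theorem yResidue_mul_sg_sr {m : ℕ} (i z : ZMod m) :
    yResidue i * sg (sr (-1 - z)) = yResidue (-(i + z)) := by
  simp only [yResidue, add_mul, sg_mul_sg, r_mul_sr, sr_mul_sr]
  rw [add_comm]
  congr 3 <;> grind

theorem sg_r_mul_yResidue {m : ℕ} {z : ZMod m} (hz : z + z = 0) (i : ZMod m) :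
    sg (r z) * yResidue i = yResidue (i + z) := by
  simp only [yResidue, mul_add, sg_mul_sg, r_mul_r, r_mul_sr]
  congr 3 <;> grind

theorem sg_sr_mul_yResidue {m : ℕ} {z : ZMod m} (hz : z + z = 0) (i : ZMod m) :
    sg (sr (-1 - z)) * yResidue i = yResidue (i + z) := by
  simp only [yResidue, mul_add, sg_mul_sg, sr_mul_r, sr_mul_sr]
  rw [add_comm]
  congr 3 <;> grind

/-- The matrix of the linear extension of `θ` to `ℝ[D_m]`. -/
noncomputable def charWeight {m : ℕ} : DihedralGroup m → DihedralGroup m → ℝ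
  | .r i, .r a => cosZMod (i * a)
  | .r i, .sr a => cosZMod (i * a)
  | .sr j, .r a => cosZMod ((j + 1) * a)
  | .sr j, .sr a => -cosZMod ((j + 1) * a)

/-- A linear extension to all of `ℝ[D_m]` of the character morphism. -/
noncomputable def charMap (m : ℕ) :
    MonoidAlgebra ℝ (DihedralGroup m) →ₗ[ℝ] (DihedralGroup m → ℝ) :=
  Finsupp.linearCombination ℝ charWeight ∘ₗ (MonoidAlgebra.coeffLinearEquiv ℝ).toLinearMap

theorem charMap_sg {m : ℕ} (g : DihedralGroup m) : charMap m (sg g) = charWeight g := by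
  simp [charMap, sg, MonoidAlgebra.coeffLinearEquiv]

theorem charWeight_mul {k : ℕ} [NeZero k] {g h : DihedralGroup (2 * k)} (hg : g ∈ kleinSet k)
    (hh : h ∈ kleinSet k) : charWeight (g * h) = charWeight g * charWeight h := by
  have hkk := natCast_half_add_self k
  have hn := neg_natCast_half k
  have h₁ : (-1 - k + 1 : ZMod (2 * k)) = k := by linear_combination -hkk
  have h₂ : (-1 + k + k + 1 : ZMod (2 * k)) = 0 := by linear_combination hkk
  simp only [kleinSet, Set.mem_insert_iff, Set.mem_singleton_iff, one_def] at hg hh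
  ext x
  rcases hg with rfl | rfl | rfl | rfl <;> rcases hh with rfl | rfl | rfl | rfl <;>
    cases x with
    | _ a =>
      have := cosZMod_half_mul_mul_self a
      simp [charWeight, -r_zero, hkk, hn, h₁, h₂, this]

theorem charMap_yResidue_r {m : ℕ} (i a : ZMod m) :
    charMap m (yResidue i) (r a) = 2 * cosZMod (i * a) := by
  simp [yResidue, charMap_sg, charWeight, two_mul]

theorem charMap_yResidue_sr {m : ℕ} (i a : ZMod m) :
    charMap m (yResidue i) (sr a) = 0 := by
  simp [yResidue, charMap_sg, charWeight]

theorem charMap_yResidue_neg {m : ℕ} [NeZero m] (i : ZMod m) :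
    charMap m (yResidue (-i)) = charMap m (yResidue i) := by
  ext x
  cases x <;> simp [charMap_yResidue_r, charMap_yResidue_sr]

theorem charMap_yResidue_mul_yResidue {m : ℕ} [NeZero m] (i j : ZMod m) :
    charMap m (yResidue i * yResidue j) = charMap m (yResidue i) * charMap m (yResidue j) := by
  rw [yResidue_mul_yResidue]
  ext x
  cases x with
  | r a =>
    have h := cosZMod_add_add_cosZMod_sub (j * a) (i * a)
    simp only [map_add, Pi.add_apply, Pi.mul_apply, charMap_yResidue_r]
    rw [add_mul, sub_mul, add_comm (i * a)]
    linear_combination 2 * h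
  | sr a => simp [charMap_yResidue_sr]

theorem charMap_yResidue_add {k : ℕ} [NeZero k] {z : ZMod (2 * k)} (hz : z = 0 ∨ z = k)
    {g : DihedralGroup (2 * k)} (hg : g = r z ∨ g = sr (-1 - z)) (i : ZMod (2 * k)) :
    charMap (2 * k) (yResidue (i + z)) = charWeight g * charMap (2 * k) (yResidue i) := by
  ext x
  cases x with
  | r a =>
    have hw : charWeight g (r a) = cosZMod (z * a) := by
      rcases hg with rfl | rfl
      · rfl
      · rw [← cosZMod_neg (z * a)]
        simp only [charWeight]
        congr 1
        ring
    rw [Pi.mul_apply, hw, charMap_yResidue_r, charMap_yResidue_r, add_mul]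
    rcases hz with rfl | rfl
    · simp
    · rw [cosZMod_add_half_mul]
      ring
  | sr a => simp [charMap_yResidue_sr]

theorem mul_mem_span_and_charMap_mul {k : ℕ} [NeZero k]
    {f g : MonoidAlgebra ℝ (DihedralGroup (2 * k))}
    (hf : f ∈ Submodule.span ℝ (evenGenerators k)) (hg : g ∈ Submodule.span ℝ (evenGenerators k)) :
    f * g ∈ Submodule.span ℝ (evenGenerators k) ∧
      charMap (2 * k) (f * g) = charMap (2 * k) f * charMap (2 * k) g := by
  have hy (i : ZMod (2 * k)) : yResidue i ∈ Submodule.span ℝ (evenGenerators k) :=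
    Submodule.subset_span (.inr ⟨i, rfl⟩)
  induction hf, hg using Submodule.span_induction₂ with
  | mem_mem f g hf hg =>
    rcases hf with ⟨x, hx, rfl⟩ | ⟨i, rfl⟩ <;> rcases hg with ⟨y, hy', rfl⟩ | ⟨j, rfl⟩
    · rw [sg_mul_sg, charMap_sg, charMap_sg, charMap_sg]
      exact ⟨Submodule.subset_span (.inl ⟨_, mul_mem_kleinSet hx hy', rfl⟩), charWeight_mul hx hy'⟩
    · obtain ⟨z, hz, hx⟩ := exists_of_mem_kleinSet hx
      have hz' := add_self_eq_zero_of_eq_zero_or_half hz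
      have h : sg x * yResidue j = yResidue (j + z) := by
        rcases hx with rfl | rfl
        · exact sg_r_mul_yResidue hz' j
        · exact sg_sr_mul_yResidue hz' j
      rw [h, charMap_sg, charMap_yResidue_add hz hx]
      exact ⟨hy _, rfl⟩
    · obtain ⟨z, hz, hx⟩ := exists_of_mem_kleinSet hy'
      have hz' := add_self_eq_zero_of_eq_zero_or_half hz
      rw [charMap_sg, mul_comm (charMap _ _), ← charMap_yResidue_add hz hx]
      rcases hx with rfl | rfl
      · rw [yResidue_mul_sg_r]
        exact ⟨hy _, rfl⟩
      · rw [yResidue_mul_sg_sr]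
        exact ⟨hy _, charMap_yResidue_neg _⟩
    · refine ⟨?_, charMap_yResidue_mul_yResidue i j⟩
      rw [yResidue_mul_yResidue]
      exact add_mem (hy _) (hy _)
  | zero_left => simp
  | zero_right => simp
  | add_left f₁ f₂ g _ _ _ h₁ h₂ =>
    rw [add_mul, map_add, map_add, add_mul, h₁.2, h₂.2]
    exact ⟨add_mem h₁.1 h₂.1, rfl⟩
  | add_right f g₁ g₂ _ _ _ h₁ h₂ =>
    rw [mul_add, map_add, map_add, mul_add, h₁.2, h₂.2]
    exact ⟨add_mem h₁.1 h₂.1, rfl⟩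
  | smul_left c f g _ _ h =>
    rw [smul_mul_assoc, map_smul, map_smul, h.2, smul_mul_assoc]
    exact ⟨Submodule.smul_mem _ c h.1, rfl⟩
  | smul_right c f g _ _ h =>
    rw [mul_smul_comm, map_smul, map_smul, h.2, mul_smul_comm]
    exact ⟨Submodule.smul_mem _ c h.1, rfl⟩

theorem famEven_inr_inl {k : ℕ} (i : Fin (k - 1)) :
    famEven k (.inr (.inl i)) = yResidue ((i.val + 1 : ℕ) : ZMod (2 * k)) := rfl

theorem famEven_inr_inr {k : ℕ} (i : Fin (k - 1)) :
    famEven k (.inr (.inr i)) = yResidue (-((i.val + 1 : ℕ) : ZMod (2 * k))) :=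
  yResidue_mul_rsElt _

theorem span_range_famEven (k : ℕ) [NeZero k] :
    Submodule.span ℝ (Set.range (famEven k)) = Submodule.span ℝ (evenGenerators k) := by
  apply le_antisymm <;> rw [Submodule.span_le]
  · rintro _ ⟨(j | i | i), rfl⟩ <;> apply Submodule.subset_span
    · left
      fin_cases j
      · exact ⟨1, by simp [kleinSet], rfl⟩
      · exact ⟨r k, by simp [kleinSet], rfl⟩
      · exact ⟨sr (-1), by simp [kleinSet], rfl⟩
      · exact ⟨sr (-(k + 1)), by simp [kleinSet], rfl⟩
    · exact .inr ⟨_, rfl⟩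
    · exact .inr ⟨_, (famEven_inr_inr i).symm⟩
  · have hfam (j) : famEven k j ∈ Submodule.span ℝ (Set.range (famEven k)) :=
      Submodule.subset_span (Set.mem_range_self j)
    rintro _ (⟨x, rfl | rfl | rfl | rfl, rfl⟩ | ⟨i, rfl⟩)
    · exact hfam (.inl 0)
    · exact hfam (.inl 1)
    · exact hfam (.inl 2)
    · exact hfam (.inl 3)
    · obtain ⟨n, hn, rfl⟩ : ∃ n : ℕ, n < 2 * k ∧ (n : ZMod (2 * k)) = i :=
        ⟨i.val, ZMod.val_lt i, ZMod.natCast_zmod_val i⟩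
      rcases Nat.eq_zero_or_pos n with rfl | hpos
      · convert add_mem (hfam (.inl 2)) (hfam (.inl 0)) using 1
        simp [yResidue, famEven, rsElt]
      rcases lt_trichotomy n k with hlt | rfl | hgt
      · convert hfam (.inr (.inl ⟨n - 1, by omega⟩)) using 1
        simp [famEven_inr_inl, Nat.cast_pred hpos]
      · convert add_mem (hfam (.inl 3)) (hfam (.inl 1)) using 1
        simp [yResidue, famEven, neg_natCast_half, sub_eq_add_neg, add_comm]
      · rw [SetLike.mem_coe]
        convert hfam (.inr (.inr ⟨2 * k - n - 1, by omega⟩)) using 1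
        have h : ((2 * k - n - 1 + 1 : ℕ) : ZMod (2 * k)) = -n := by
          rw [Nat.sub_add_cancel (by omega), Nat.cast_sub hn.le, ZMod.natCast_self, zero_sub]
        rw [famEven_inr_inr, h, neg_neg]

theorem linearIndependent_famEven (k : ℕ) [NeZero k] : LinearIndependent ℝ (famEven k) := by
  let p : (Fin 4 ⊕ (Fin (k - 1) ⊕ Fin (k - 1))) → DihedralGroup (2 * k) :=
    Sum.elim ![1, r k, sr (-1), sr (-(k + 1))]
      (Sum.elim (fun i => r ((i.val + 1 : ℕ) : ZMod (2 * k)))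
        (fun i => r (-((i.val + 1 : ℕ) : ZMod (2 * k)))))
  let φ : MonoidAlgebra ℝ (DihedralGroup (2 * k)) →ₗ[ℝ]
      ((Fin 4 ⊕ (Fin (k - 1) ⊕ Fin (k - 1))) → ℝ) :=
    LinearMap.pi fun j => Finsupp.lapply (p j) ∘ₗ (MonoidAlgebra.coeffLinearEquiv ℝ).toLinearMap
  have hφ (f j) : φ f j = f.coeff (p j) := rfl
  have hn := neg_natCast_half k
  have cast_eq {a b : ℕ} (ha : a < 2 * k) (hb : b < 2 * k) :
      (a : ZMod (2 * k)) = b ↔ a = b := by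
    rw [ZMod.natCast_eq_natCast_iff', Nat.mod_eq_of_lt ha, Nat.mod_eq_of_lt hb]
  have hk := NeZero.pos k
  have hk0 : (k : ZMod (2 * k)) ≠ 0 := by
    rw [← Nat.cast_zero, Ne, cast_eq] <;> omega
  have h0 (i : Fin (k - 1)) : ((i.val + 1 : ℕ) : ZMod (2 * k)) ≠ 0 := by
    rw [← Nat.cast_zero, Ne, cast_eq] <;> omega
  have h1 (i : Fin (k - 1)) : ((i.val + 1 : ℕ) : ZMod (2 * k)) ≠ k := by
    rw [Ne, cast_eq] <;> omega
  have h2 (i j : Fin (k - 1)) :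
      ((i.val + 1 : ℕ) : ZMod (2 * k)) + ((j.val + 1 : ℕ) : ZMod (2 * k)) ≠ 0 := by
    rw [← Nat.cast_add, ← Nat.cast_zero, Ne, cast_eq] <;> omega
  have h3 (i j : Fin (k - 1)) :
      ((i.val + 1 : ℕ) : ZMod (2 * k)) = ((j.val + 1 : ℕ) : ZMod (2 * k)) ↔ i = j := by
    rw [cast_eq, Fin.ext_iff] <;> omega
  have n1 (i : Fin (k - 1)) : (k : ZMod (2 * k)) ≠ -((i.val + 1 : ℕ) : ZMod (2 * k)) := by
    rw [← hn, Ne, neg_inj]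
    exact (h1 i).symm
  have n2 (i : Fin (k - 1)) : ((i.val + 1 : ℕ) : ZMod (2 * k)) - 1 ≠ -1 + -k := by
    rw [hn, neg_add_eq_sub, Ne, sub_left_inj]
    exact h1 i
  have n3 (i : Fin (k - 1)) : -((i.val + 1 : ℕ) : ZMod (2 * k)) - 1 ≠ -1 + -k := by
    rw [hn, neg_add_eq_sub, Ne, sub_left_inj]
    exact (n1 i).symm
  have n4 (i j : Fin (k - 1)) :
      ((i.val + 1 : ℕ) : ZMod (2 * k)) ≠ -((j.val + 1 : ℕ) : ZMod (2 * k)) := by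
    rw [Ne, eq_neg_iff_add_eq_zero]
    exact h2 i j
  refine LinearIndependent.of_comp φ ?_
  have key : φ ∘ famEven k = Pi.basisFun ℝ _ := by
    funext i j
    rw [Function.comp_apply, hφ, Pi.basisFun_apply, Pi.single_apply]
    rcases i with i | i | i <;> rcases j with j | j | j
    · fin_cases i <;> fin_cases j <;>
        simp [famEven, p, coeff_sg, rsElt, one_def, -r_zero, hk0, hk0.symm]
    · fin_cases i <;>
        simp [famEven, p, coeff_sg, rsElt, one_def, -r_zero, (h0 j).symm, (h1 j).symm,
          -Nat.cast_add]
    · fin_cases i <;>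
        simp [famEven, p, coeff_sg, rsElt, one_def, -r_zero, h0 j, n1 j, -Nat.cast_add]
    · fin_cases j <;>
        simp [famEven_inr_inl, yResidue, p, coeff_sg, one_def, -r_zero, h0 i, h1 i, n2 i,
          -Nat.cast_add]
    · simp [famEven_inr_inl, yResidue, p, coeff_sg, h3, eq_comm, -Nat.cast_add]
    · simp [famEven_inr_inl, yResidue, p, coeff_sg, n4, -Nat.cast_add]
    · fin_cases j <;>
        simp [famEven_inr_inr, yResidue, p, coeff_sg, one_def, -r_zero, h0 i, (n1 i).symm, n3 i,
          -Nat.cast_add]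
    · simp [famEven_inr_inr, yResidue, p, coeff_sg, (n4 _ _).symm, -Nat.cast_add]
    · simp [famEven_inr_inr, yResidue, p, coeff_sg, h3, eq_comm, -Nat.cast_add]
  rw [key]
  exact (Pi.basisFun ℝ _).linearIndependent

/-- **The subalgebra `Q` of `ℝ[D_m]` and the morphism onto the character algebra
(`m = 2k` even).**  (i) The `2k+2` elements `e, r^k, rs, r^{k+1}s, y_i, y_i·rs`
(`1 ≤ i ≤ k-1`) are linearly independent and their span `Q` is closed under
multiplication.  (ii) Any linear map `θ : Q → (D_m → ℝ)` with `θ(e) = id`,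
`θ(rs) = ε`, `θ(r^k) = γ`, `θ(r^{k+1}s) = γε` and `θ(y_i) = θ(y_i·rs) = χ_i` is
multiplicative on `Q`, and its image is the `ℝ`-span of the irreducible characters. -/
theorem dihedral_even_subalgebra_and_character_morphism (k : ℕ) (hk : 1 ≤ k) :
    LinearIndependent ℝ (famEven k) ∧
    (∀ f g : MonoidAlgebra ℝ (DihedralGroup (2 * k)),
      f ∈ Submodule.span ℝ (Set.range (famEven k)) →
      g ∈ Submodule.span ℝ (Set.range (famEven k)) →
      f * g ∈ Submodule.span ℝ (Set.range (famEven k))) ∧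
    (∀ θ : (Submodule.span ℝ (Set.range (famEven k))) →ₗ[ℝ] (DihedralGroup (2 * k) → ℝ),
      θ ⟨famEven k (Sum.inl 0), Submodule.subset_span (Set.mem_range_self _)⟩ = chiId (2 * k) →
      θ ⟨famEven k (Sum.inl 2), Submodule.subset_span (Set.mem_range_self _)⟩ = chiEps (2 * k) →
      θ ⟨famEven k (Sum.inl 1), Submodule.subset_span (Set.mem_range_self _)⟩ = chiGamma (2 * k) →
      θ ⟨famEven k (Sum.inl 3), Submodule.subset_span (Set.mem_range_self _)⟩
          = chiGammaEps (2 * k) →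
      (∀ i : Fin (k - 1),
        θ ⟨famEven k (Sum.inr (Sum.inl i)), Submodule.subset_span (Set.mem_range_self _)⟩
          = chiJ (2 * k) (i.val + 1)) →
      (∀ i : Fin (k - 1),
        θ ⟨famEven k (Sum.inr (Sum.inr i)), Submodule.subset_span (Set.mem_range_self _)⟩
          = chiJ (2 * k) (i.val + 1)) →
      ((∀ (f g : MonoidAlgebra ℝ (DihedralGroup (2 * k)))
          (hf : f ∈ Submodule.span ℝ (Set.range (famEven k)))
          (hg : g ∈ Submodule.span ℝ (Set.range (famEven k)))
          (hfg : f * g ∈ Submodule.span ℝ (Set.range (famEven k))),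
          θ ⟨f * g, hfg⟩ = θ ⟨f, hf⟩ * θ ⟨g, hg⟩) ∧
        LinearMap.range θ = Submodule.span ℝ
          ({chiId (2 * k), chiEps (2 * k), chiGamma (2 * k), chiGammaEps (2 * k)} ∪
            Set.range fun j : Fin (k - 1) => chiJ (2 * k) (j.val + 1)))) := by
  have : NeZero k := ⟨by omega⟩
  have hk0 (a : ZMod (2 * k)) := cosZMod_half_mul a
  have e0 : charMap (2 * k) (famEven k (.inl 0)) = chiId (2 * k) := by
    ext (a | a) <;> simp [famEven, charMap_sg, one_def, -r_zero, charWeight, chiId]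
  have e1 : charMap (2 * k) (famEven k (.inl 1)) = chiGamma (2 * k) := by
    ext (a | a) <;> simp [famEven, charMap_sg, charWeight, chiGamma, hk0]
  have e2 : charMap (2 * k) (famEven k (.inl 2)) = chiEps (2 * k) := by
    ext (a | a) <;> simp [famEven, rsElt, charMap_sg, charWeight, chiEps]
  have e3 : charMap (2 * k) (famEven k (.inl 3)) = chiGammaEps (2 * k) := by
    ext (a | a) <;> simp [famEven, charMap_sg, charWeight, chiGammaEps, hk0, pow_succ]
  have ey (n : ℕ) : charMap (2 * k) (yResidue (n : ZMod (2 * k))) = chiJ (2 * k) n := by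
    ext (a | a)
    · have h : (n : ZMod (2 * k)) * a = ((n * a.val : ℕ) : ZMod (2 * k)) := by
        rw [Nat.cast_mul, ZMod.natCast_zmod_val]
      rw [charMap_yResidue_r, h, cosZMod_natCast]
      simp [chiJ, mul_assoc]
    · rw [charMap_yResidue_sr, chiJ]
  have e4 (i : Fin (k - 1)) :
      charMap (2 * k) (famEven k (.inr (.inl i))) = chiJ (2 * k) (i.val + 1) := ey _
  have e5 (i : Fin (k - 1)) :
      charMap (2 * k) (famEven k (.inr (.inr i))) = chiJ (2 * k) (i.val + 1) := by
    rw [famEven_inr_inr, charMap_yResidue_neg, ey]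
  have hmul {f g : MonoidAlgebra ℝ (DihedralGroup (2 * k))}
      (hf : f ∈ Submodule.span ℝ (Set.range (famEven k)))
      (hg : g ∈ Submodule.span ℝ (Set.range (famEven k))) :
      f * g ∈ Submodule.span ℝ (Set.range (famEven k)) ∧
        charMap (2 * k) (f * g) = charMap (2 * k) f * charMap (2 * k) g := by
    rw [span_range_famEven] at hf hg ⊢
    exact mul_mem_span_and_charMap_mul hf hg
  refine ⟨linearIndependent_famEven k, fun f g hf hg => (hmul hf hg).1, ?_⟩
  intro θ t0 t2 t1 t3 t4 t5
  have hθ (f) (hf : f ∈ Submodule.span ℝ (Set.range (famEven k))) :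
      θ ⟨f, hf⟩ = charMap (2 * k) f := by
    have hgen (j) : θ ⟨famEven k j, Submodule.subset_span (Set.mem_range_self _)⟩ =
        charMap (2 * k) (famEven k j) := by
      rcases j with j | i | i
      · fin_cases j
        exacts [t0.trans e0.symm, t1.trans e1.symm, t2.trans e2.symm, t3.trans e3.symm]
      · exact (t4 i).trans (e4 i).symm
      · exact (t5 i).trans (e5 i).symm
    induction hf using Submodule.span_induction with
    | mem x hx =>
      obtain ⟨j, rfl⟩ := hx
      exact hgen j
    | zero => exact (map_zero θ).trans (map_zero _).symm
    | add x y hx hy h₁ h₂ =>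
      rw [map_add, ← h₁, ← h₂, ← map_add]
      rfl
    | smul c x hx h =>
      rw [map_smul, ← h, ← map_smul]
      rfl
  refine ⟨fun f g hf hg hfg => ?_, ?_⟩
  · rw [hθ, hθ, hθ, (hmul hf hg).2]
  · have h : θ = charMap (2 * k) ∘ₗ (Submodule.span ℝ (Set.range (famEven k))).subtype :=
      LinearMap.ext fun x => hθ x.1 x.2
    rw [h, LinearMap.range_comp, Submodule.range_subtype, Submodule.map_span, ← Set.range_comp]
    congr 1
    ext x
    simp only [Set.mem_range, Sum.exists, Fin.exists_fin_succ, Function.comp_apply, Set.mem_union,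
      Set.mem_insert_iff, Set.mem_singleton_iff, e4, e5, or_self]
    simp [e0, e1, e2, e3, eq_comm]
    tauto
end

section
/- Let m ≥ 3 and let ρ : D_m → GL_2(ℂ) be the geometric representation, defined by ρ(r) = [[cos(2π/m), −sin(2π/m)], [sin(2π/m), cos(2π/m)]] and ρ(s) = [[1, 0], [0, −1]]. For every d ≥ 0, the dimension over ℂ of the space of D_m-invariant tensors in (ℂ²)^{⊗d} (with the diagonal action induced by ρ) equals the number of words of length d over {r, s} that reduce to the identity e in D_m. -/
open DihedralGroup

/-- The representation of `D_m` on `ℂ²` obtained from a matrix representation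
`ρ : D_m →* M₂(ℂ)`. -/
noncomputable def matRep {m : ℕ} (ρ : DihedralGroup m →* Matrix (Fin 2) (Fin 2) ℂ) :
    Representation ℂ (DihedralGroup m) (Fin 2 → ℂ) :=
  ((Matrix.toLinAlgEquiv' :
      Matrix (Fin 2) (Fin 2) ℂ ≃ₐ[ℂ]
        ((Fin 2 → ℂ) →ₗ[ℂ] (Fin 2 → ℂ))).toAlgHom.toRingHom.toMonoidHom).comp ρ

/-- The `d`-fold tensor power of a representation, with diagonal action. -/
noncomputable def tpowRep {G V : Type*} [Group G] [AddCommGroup V] [Module ℂ V]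
    (ρ : Representation ℂ G V) (d : ℕ) :
    Representation ℂ G (PiTensorProduct ℂ (fun _ : Fin d => V)) where
  toFun g := PiTensorProduct.map fun _ => ρ g
  map_one' := by
    show PiTensorProduct.map (fun _ : Fin d => ρ 1) = 1
    have : (fun _ : Fin d => ρ 1) = fun _ : Fin d => (1 : V →ₗ[ℂ] V) := by
      funext _; rw [map_one]
    rw [this, PiTensorProduct.map_one]
  map_mul' g h := by
    show PiTensorProduct.map (fun _ : Fin d => ρ (g * h)) =
      PiTensorProduct.map (fun _ : Fin d => ρ g) * PiTensorProduct.map (fun _ : Fin d => ρ h)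
    have : (fun _ : Fin d => ρ (g * h)) = fun _ : Fin d => ρ g * ρ h := by
      funext _; rw [map_mul]
    rw [this, PiTensorProduct.map_mul]

/-- The dimension over `ℂ` of the space of `G`-invariant tensors in the `d`-fold
tensor power `V^{⊗d}` (with diagonal `G`-action) of a representation on `V`. -/
noncomputable def invariantDim {G V : Type*} [Group G] [AddCommGroup V] [Module ℂ V]
    (ρ : Representation ℂ G V) (d : ℕ) : ℕ :=
  Module.finrank ℂ ((tpowRep ρ d).invariants)

/-- The trace of the `d`-fold tensor power of an endomorphism is the `d`-th power of its trace. -/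
theorem PiTensorProduct.trace_map_const {K V : Type*} [Field K] [AddCommGroup V] [Module K V]
    [FiniteDimensional K V] (f : V →ₗ[K] V) (d : ℕ) :
    LinearMap.trace K _ (PiTensorProduct.map fun _ : Fin d => f) = LinearMap.trace K V f ^ d := by
  classical
  have b := Module.finBasis K V
  rw [LinearMap.trace_eq_matrix_trace K (Basis.piTensorProduct fun _ : Fin d => b),
    LinearMap.trace_eq_matrix_trace K b]
  simp only [Matrix.trace, Matrix.diag_apply, LinearMap.toMatrix_apply,
    Basis.piTensorProduct_apply, PiTensorProduct.map_tprod,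
    Basis.piTensorProduct_repr_tprod_apply]
  rw [Fintype.sum_pow]

/-- Noncommutative distributivity: the sum of the products of all words of length `d`. -/
theorem sum_prod_ofFn_eq_pow {α R : Type*} [Fintype α] [Semiring R] (f : α → R) (d : ℕ) :
    ∑ w : Fin d → α, (List.ofFn fun i => f (w i)).prod = (∑ a, f a) ^ d := by
  induction d with
  | zero => simp
  | succ d ih =>
    rw [← (Fin.consEquiv fun _ : Fin (d + 1) => α).sum_comp, Fintype.sum_prod_type, pow_succ',
      ← ih, Finset.sum_mul_sum]
    simp [Fin.consEquiv, List.ofFn_succ]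

/-- Powers of a singular `2 × 2` matrix are multiples of it. -/
theorem Matrix.pow_succ_of_det_fin_two_eq_zero {R : Type*} [CommRing R]
    {A : Matrix (Fin 2) (Fin 2) R} (hA : A.det = 0) (d : ℕ) :
    A ^ (d + 1) = A.trace ^ d • A := by
  induction d with
  | zero => simp
  | succ d ih =>
    have hsq : A * A = A.trace • A := by
      rw [Matrix.det_fin_two] at hA
      ext i j
      fin_cases i <;> fin_cases j <;>
        simp [Matrix.mul_apply, Fin.sum_univ_two, Matrix.trace_fin_two] <;>
        grind
    rw [pow_succ, ih, smul_mul_assoc, hsq, smul_smul, pow_succ]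

/-- The dimension of the invariants of a tensor power is the average of the corresponding power
of the character. -/
theorem card_mul_invariantDim {G V : Type*} [Group G] [Fintype G] [AddCommGroup V] [Module ℂ V]
    [FiniteDimensional ℂ V] (ρ : Representation ℂ G V) (d : ℕ) :
    (Nat.card G : ℂ) * invariantDim ρ d = ∑ g, ρ.character g ^ d := by
  have hG : (Nat.card G : ℂ) ≠ 0 := Nat.cast_ne_zero.mpr Nat.card_pos.ne'
  let _ : Invertible (Nat.card G : ℂ) := invertibleOfNonzero hG
  rw [invariantDim, ← Representation.card_inv_mul_sum_char_eq_finrank, mul_inv_cancel_left₀ hG]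
  exact Finset.sum_congr rfl fun g _ => PiTensorProduct.trace_map_const (ρ g) d

namespace DihedralGroup

/-- The endomorphism of `D_m` multiplying all indices by `k`. -/
def scaleIndex {m : ℕ} (k : ZMod m) : DihedralGroup m →* DihedralGroup m where
  toFun
    | r i => r (i * k)
    | sr i => sr (i * k)
  map_one' := by simp [one_def, -r_zero]
  map_mul' := by rintro (i | i) (j | j) <;> simp [add_mul, sub_mul]

@[simp]
theorem scaleIndex_r {m : ℕ} (k i : ZMod m) : scaleIndex k (r i) = r (i * k) := rfl

@[simp]
theorem scaleIndex_sr {m : ℕ} (k i : ZMod m) : scaleIndex k (sr i) = sr (i * k) := rfl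

theorem sum_eq_sum_r_add_sum_sr {m : ℕ} [NeZero m] {M : Type*} [AddCommMonoid M]
    (f : DihedralGroup m → M) : ∑ g, f g = ∑ i, f (r i) + ∑ i, f (sr i) := by
  rw [← (equivSum (n := m)).symm.sum_comp, Fintype.sum_sum_type]
  rfl

open ZMod (stdAddChar)

section Geometric

variable {m : ℕ} [NeZero m] {ρ : DihedralGroup m →* Matrix (Fin 2) (Fin 2) ℂ}
  (hρr : ρ (r 1) =
    !![(Real.cos (2 * Real.pi / m) : ℂ), -(Real.sin (2 * Real.pi / m) : ℂ);
       (Real.sin (2 * Real.pi / m) : ℂ), (Real.cos (2 * Real.pi / m) : ℂ)])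
  (hρs : ρ (sr 0) = !![1, 0; 0, -1])

include hρr in
theorem exists_geom_r (j : ZMod m) : ∃ c s : ℂ, ρ (r j) = !![c, -s; s, c] ∧
    c ^ 2 + s ^ 2 = 1 ∧ 2 * c = stdAddChar j + stdAddChar (-j) := by
  obtain ⟨k, rfl⟩ := ZMod.natCast_zmod_surjective j
  set θ : ℂ := 2 * Real.pi / m with hθ
  have hpow : ρ (r (k : ZMod m)) =
      !![Complex.cos (k * θ), -Complex.sin (k * θ); Complex.sin (k * θ), Complex.cos (k * θ)] := by
    induction k with
    | zero => simp [Matrix.one_fin_two]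
    | succ k ih =>
      have hstep : (r ((k + 1 : ℕ) : ZMod m) : DihedralGroup m) = r (k : ZMod m) * r 1 := by simp
      rw [hstep, map_mul, ih, hρr, Nat.cast_succ, add_mul, one_mul, Complex.cos_add,
        Complex.sin_add]
      push_cast
      rw [← hθ]
      ext i j
      fin_cases i <;> fin_cases j <;> simp <;> ring
  refine ⟨_, _, hpow, Complex.cos_sq_add_sin_sq _, ?_⟩
  have h₁ := ZMod.stdAddChar_coe (N := m) k
  have h₂ := ZMod.stdAddChar_coe (N := m) (-k)
  push_cast at h₁ h₂
  rw [h₁, h₂, Complex.two_cos]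
  congr 2 <;> rw [hθ] <;> ring

include hρr in
theorem trace_geom_r (j : ZMod m) :
    (ρ (r j)).trace = stdAddChar j + stdAddChar (-j) := by
  obtain ⟨c, s, h, -, hc⟩ := exists_geom_r hρr j
  simp [h, Matrix.trace_fin_two, ← hc, two_mul]

include hρr hρs in
theorem trace_geom_sr (j : ZMod m) : (ρ (sr j)).trace = 0 := by
  obtain ⟨c, s, h, -, -⟩ := exists_geom_r hρr j
  have hj : (sr j : DihedralGroup m) = sr 0 * r j := by simp
  rw [hj, map_mul, h, hρs]
  simp [Matrix.trace_fin_two]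

include hρr hρs in
theorem trace_geom_r_add_s_pow_succ (j : ZMod m) (d : ℕ) :
    ((ρ (r j) + ρ (sr 0)) ^ (d + 1)).trace = (ρ (r j)).trace ^ (d + 1) := by
  obtain ⟨c, s, h, hcs, -⟩ := exists_geom_r hρr j
  have hdet : (ρ (r j) + ρ (sr 0)).det = 0 := by
    simp only [h, hρs, Matrix.det_fin_two]
    simp
    linear_combination hcs
  rw [Matrix.pow_succ_of_det_fin_two_eq_zero hdet, Matrix.trace_smul, Matrix.trace_add, hρs]
  simp [Matrix.trace_fin_two, pow_succ]

include hρr hρs in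
theorem sum_trace_geom_pow (d : ℕ) :
    ∑ g, (ρ g).trace ^ d = ∑ k, ((ρ (r k) + ρ (sr 0)) ^ d).trace := by
  cases d with
  | zero => simp [card, mul_comm]
  | succ d =>
    simp [sum_eq_sum_r_add_sum_sr, trace_geom_sr hρr hρs, trace_geom_r_add_s_pow_succ hρr hρs]

include hρr hρs in
theorem sum_trace_geom_scaleIndex (g : DihedralGroup m) :
    ∑ k, (ρ (scaleIndex k g)).trace = if g = 1 then (Nat.card (DihedralGroup m) : ℂ) else 0 := by
  have hψ := ZMod.isPrimitive_stdAddChar m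
  rcases g with i | i
  · have h₁ := AddChar.sum_mulShift i hψ
    have h₂ := AddChar.sum_mulShift (-i) hψ
    simp only [mul_neg, neg_eq_zero] at h₂
    simp only [scaleIndex_r, trace_geom_r hρr, Finset.sum_add_distrib, mul_comm i, h₁, h₂,
      one_def, r.injEq, nat_card, ZMod.card]
    split_ifs <;> push_cast <;> ring
  · simp [trace_geom_sr hρr hρs, one_def, -r_zero]

include hρr hρs in
theorem sum_trace_geom_r_add_s_pow (d : ℕ) :
    ∑ k, ((ρ (r k) + ρ (sr 0)) ^ d).trace = Nat.card (DihedralGroup m) *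
      (Nat.card {w : Fin d → {x // x ∈ ({r 1, sr 0} : Finset (DihedralGroup m))} //
        (List.ofFn fun i => (w i : DihedralGroup m)).prod = 1} : ℂ) := by
  have hwords (k : ZMod m) : (ρ (r k) + ρ (sr 0)) ^ d =
      ∑ w : Fin d → {x // x ∈ ({r 1, sr 0} : Finset (DihedralGroup m))},
        ρ (scaleIndex k (List.ofFn fun i => (w i : DihedralGroup m)).prod) := by
    have hsum : ∑ x : {x // x ∈ ({r 1, sr 0} : Finset (DihedralGroup m))},
        ρ (scaleIndex k x) = ρ (r k) + ρ (sr 0) := by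
      rw [Finset.sum_coe_sort _ fun x => ρ (scaleIndex k x), Finset.sum_pair (by simp)]
      simp
    rw [← hsum, ← sum_prod_ofFn_eq_pow]
    simp only [map_list_prod, List.map_ofFn]
    rfl
  simp_rw [hwords, Matrix.trace_sum]
  rw [Finset.sum_comm]
  simp_rw [sum_trace_geom_scaleIndex hρr hρs]
  rw [← Finset.sum_filter, Finset.sum_const, nsmul_eq_mul, mul_comm, Nat.card_eq_fintype_card
    (α := {w : Fin d → _ // _}), Fintype.card_subtype]

end Geometric

end DihedralGroup

/-- **Invariants of the geometric module of the dihedral group count words reducing to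
the identity.**  Let `m ≥ 3` and let `ρ : D_m → GL₂(ℂ)` be the geometric representation,
with `ρ(r)` the rotation by `2π/m` and `ρ(s) = [[1,0],[0,-1]]`.  For every `d ≥ 0`, the
dimension of the space of `D_m`-invariant tensors in `(ℂ²)^{⊗d}` equals the number of
words of length `d` over `{r, s}` which reduce to the identity in `D_m`. -/
theorem dihedral_geom_invariant_dim_eq_wordCount (m : ℕ) (hm : 3 ≤ m)
    (ρ : DihedralGroup m →* Matrix (Fin 2) (Fin 2) ℂ)
    (hρr : ρ (r 1) =
      !![(Real.cos (2 * Real.pi / m) : ℂ), -(Real.sin (2 * Real.pi / m) : ℂ);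
         (Real.sin (2 * Real.pi / m) : ℂ), (Real.cos (2 * Real.pi / m) : ℂ)])
    (hρs : ρ (sr 0) = !![1, 0; 0, -1])
    (d : ℕ) :
    invariantDim (matRep ρ) d =
      Nat.card {w : Fin d → {x // x ∈ ({r 1, sr 0} : Finset (DihedralGroup m))} //
        (List.ofFn fun i => (w i : DihedralGroup m)).prod = 1} := by
  have : NeZero m := ⟨by omega⟩
  have hchar (g : DihedralGroup m) : (matRep ρ).character g = (ρ g).trace :=
    Matrix.trace_toLin'_eq _
  have hcard : (Nat.card (DihedralGroup m) : ℂ) ≠ 0 := Nat.cast_ne_zero.mpr Nat.card_pos.ne'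
  refine Nat.cast_injective (R := ℂ) (mul_left_cancel₀ hcard ?_)
  simp_rw [card_mul_invariantDim, hchar]
  rw [sum_trace_geom_pow hρr hρs, sum_trace_geom_r_add_s_pow hρr hρs]
end
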